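/- Let a∈[0,1]², q≥0 and t∈ℝ with t > γ(q), where γ is the moment scaling function. Then there exists a constant K (depending on t and q but not on δ) such that Σ_{𝔦∈𝓘_{a,δ}} ψ^{t,q}_a(𝔦) ≤ K for all δ∈(0,1], where 𝓘_{a,δ} = {𝔦∈𝓘* : α₂(D_aS_𝔦) < δ ≤ α₂(D_aS_{𝔦̂})} is the δ-stopping and 𝔦̂ denotes 𝔦 with its last letter deleted. -/

import Mathlib

/-!
Setting (Falconer–Fraser–Lee, "L^q-spectra of measures on planar non-conformal attractors"):
a finite family of C^{1+α} skew-product contractions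
`S i (x,y) = (f i x, g i (x,y))` of the unit square, satisfying a domination
condition on the (lower triangular) Jacobians.
-/

open Set Filter Topology MeasureTheory
open scoped Classical ENNReal

noncomputable section

/-- The closed unit square `[0,1]² ⊆ ℝ²`. -/
def unitSq : Set (ℝ × ℝ) := Set.Icc (0:ℝ) 1 ×ˢ Set.Icc (0:ℝ) 1

variable {ι : Type*} [Fintype ι]

/-- The skew-product map `S_i(x,y) = (f_i x, g_i (x,y))`. -/
def Smap (f : ι → ℝ → ℝ) (g : ι → ℝ × ℝ → ℝ) (i : ι) : ℝ × ℝ → ℝ × ℝ :=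
  fun a => (f i a.1, g i a)

/-- The composition `S_𝔦 = S_{i₁} ∘ ⋯ ∘ S_{i_k}` along a finite word `𝔦 = [i₁, …, i_k]`. -/
def Sword (f : ι → ℝ → ℝ) (g : ι → ℝ × ℝ → ℝ) : List ι → ℝ × ℝ → ℝ × ℝ
  | [] => id
  | i :: l => Smap f g i ∘ Sword f g l

/-- The first component `f_𝔦 = f_{i₁} ∘ ⋯ ∘ f_{i_k}` of `S_𝔦` (a function of `x` only). -/
def fword (f : ι → ℝ → ℝ) : List ι → ℝ → ℝ
  | [] => id
  | i :: l => f i ∘ fword f l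

/-- Top-left entry `f_{𝔦,x}(a)` of the (lower triangular) Jacobian `D_a S_𝔦`. -/
def fxw (f : ι → ℝ → ℝ) (g : ι → ℝ × ℝ → ℝ) (l : List ι) (a : ℝ × ℝ) : ℝ :=
  deriv (fun x => (Sword f g l (x, a.2)).1) a.1

/-- Bottom-left entry `g_{𝔦,x}(a)` of the Jacobian `D_a S_𝔦`. -/
def gxw (f : ι → ℝ → ℝ) (g : ι → ℝ × ℝ → ℝ) (l : List ι) (a : ℝ × ℝ) : ℝ :=
  deriv (fun x => (Sword f g l (x, a.2)).2) a.1

/-- Bottom-right entry `g_{𝔦,y}(a)` of the Jacobian `D_a S_𝔦`. -/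
def gyw (f : ι → ℝ → ℝ) (g : ι → ℝ × ℝ → ℝ) (l : List ι) (a : ℝ × ℝ) : ℝ :=
  deriv (fun y => (Sword f g l (a.1, y)).2) a.2

/-- The standing hypotheses: `|𝓘| ≥ 2`; each `S_i(x,y) = (f_i x, g_i(x,y))` maps the unit
square into itself; `f_i, g_i` are `C^{1+α}` contractions (`0 < α ≤ 1`); and the
domination condition `inf f_{i,x} > sup g_{i,y} ≥ inf g_{i,y} ≥ d > 0` holds. -/
structure IFSHyp (f : ι → ℝ → ℝ) (g : ι → ℝ × ℝ → ℝ) (α d : ℝ) : Prop where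
  card2 : 2 ≤ Fintype.card ι
  alpha_pos : 0 < α
  alpha_le_one : α ≤ 1
  d_pos : 0 < d
  maps_f : ∀ i, Set.MapsTo (f i) (Set.Icc 0 1) (Set.Icc 0 1)
  maps_g : ∀ i, Set.MapsTo (g i) unitSq (Set.Icc 0 1)
  diff_f : ∀ i, Differentiable ℝ (f i)
  diff_g : ∀ i, Differentiable ℝ (g i)
  holder_f : ∀ i, ∃ H : ℝ, ∀ x ∈ Set.Icc (0:ℝ) 1, ∀ y ∈ Set.Icc (0:ℝ) 1,
      |deriv (f i) x - deriv (f i) y| ≤ H * |x - y| ^ α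
  holder_g : ∀ i, ∃ H : ℝ, ∀ a ∈ unitSq, ∀ b ∈ unitSq,
      ‖fderiv ℝ (g i) a - fderiv ℝ (g i) b‖ ≤ H * ‖a - b‖ ^ α
  contr_f : ∀ i, ∃ c, 0 ≤ c ∧ c < 1 ∧ ∀ x ∈ Set.Icc (0:ℝ) 1, ∀ y ∈ Set.Icc (0:ℝ) 1,
      |f i x - f i y| ≤ c * |x - y|
  contr_g : ∀ i, ∃ c, 0 ≤ c ∧ c < 1 ∧ ∀ a ∈ unitSq, ∀ b ∈ unitSq,
      |g i a - g i b| ≤ c * ‖a - b‖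
  dom : ∀ i, sSup (gyw f g [i] '' unitSq) < sInf (fxw f g [i] '' unitSq)
  dom_d : ∀ i, ∀ a ∈ unitSq, d ≤ gyw f g [i] a

/-- The larger singular value of the lower triangular matrix `A = [[a,0],[b,c]]`, i.e. the
square root of the larger eigenvalue of `AᵀA`, in explicit closed form. -/
def sv1 (a b c : ℝ) : ℝ :=
  Real.sqrt (((a ^ 2 + b ^ 2 + c ^ 2) +
    Real.sqrt ((a ^ 2 + b ^ 2 + c ^ 2) ^ 2 - 4 * (a * c) ^ 2)) / 2)

/-- The smaller singular value of the lower triangular matrix `A = [[a,0],[b,c]]`, i.e. the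
square root of the smaller eigenvalue of `AᵀA`, in explicit closed form. -/
def sv2 (a b c : ℝ) : ℝ :=
  Real.sqrt (((a ^ 2 + b ^ 2 + c ^ 2) -
    Real.sqrt ((a ^ 2 + b ^ 2 + c ^ 2) ^ 2 - 4 * (a * c) ^ 2)) / 2)

/-- `α₁(D_a S_𝔦)`, the larger singular value of the Jacobian. -/
def alphaOne (f : ι → ℝ → ℝ) (g : ι → ℝ × ℝ → ℝ) (l : List ι) (a : ℝ × ℝ) : ℝ :=
  sv1 (fxw f g l a) (gxw f g l a) (gyw f g l a)

/-- `α₂(D_a S_𝔦)`, the smaller singular value of the Jacobian. -/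
def alphaTwo (f : ι → ℝ → ℝ) (g : ι → ℝ × ℝ → ℝ) (l : List ι) (a : ℝ × ℝ) : ℝ :=
  sv2 (fxw f g l a) (gxw f g l a) (gyw f g l a)

/-- `η = sup_{i, a, b} g_{i,y}(a) / f_{i,x}(b)`. -/
def etaSup (f : ι → ℝ → ℝ) (g : ι → ℝ × ℝ → ℝ) : ℝ :=
  sSup {x : ℝ | ∃ i : ι, ∃ a ∈ unitSq, ∃ b ∈ unitSq, x = gyw f g [i] a / fxw f g [i] b}

/-- `p(𝔦) = p_{i₁} ⋯ p_{i_k}`. -/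
def pword (p : ι → ℝ) (l : List ι) : ℝ := (l.map p).prod

/-- `(p_i)` is a probability vector with all entries in `(0,1)`. -/
def ProbVec (p : ι → ℝ) : Prop := (∀ i, 0 < p i ∧ p i < 1) ∧ ∑ i, p i = 1

/-- The `q`-modified singular value function
`ψ^{s,q}_a(𝔦) = p(𝔦)^q α₁(D_aS_𝔦)^βq α₂(D_aS_𝔦)^(s−βq)` (real exponents). -/
def psiSV (f : ι → ℝ → ℝ) (g : ι → ℝ × ℝ → ℝ) (p : ι → ℝ) (s q βq : ℝ)
    (a : ℝ × ℝ) (l : List ι) : ℝ :=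
  pword p l ^ q * alphaOne f g l a ^ βq * alphaTwo f g l a ^ (s - βq)

/-- `Ψ^{s,q}_{a,k} = Σ_{𝔦 ∈ 𝓘^k} ψ^{s,q}_a(𝔦)`. -/
def PsiSum (f : ι → ℝ → ℝ) (g : ι → ℝ × ℝ → ℝ) (p : ι → ℝ) (s q βq : ℝ)
    (a : ℝ × ℝ) (k : ℕ) : ℝ :=
  ∑ w : Fin k → ι, psiSV f g p s q βq a (List.ofFn w)

/-- The `δ`-stopping `𝓘_{a,δ} = {𝔦 : α₂(D_aS_𝔦) < δ ≤ α₂(D_aS_𝔦̂)}`, where `𝔦̂` drops the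
last letter of `𝔦`. -/
def stopping (f : ι → ℝ → ℝ) (g : ι → ℝ × ℝ → ℝ) (a : ℝ × ℝ) (δ : ℝ) : Set (List ι) :=
  {l | l ≠ [] ∧ alphaTwo f g l a < δ ∧ δ ≤ alphaTwo f g l.dropLast a}

/-- `q`-th power moment sum of a measure on `ℝ` over the `δ`-mesh intervals of positive
measure. -/
def msum1 (ν : Measure ℝ) (q δ : ℝ) : ℝ :=
  ∑' k : ℤ, if 0 < ν (Set.Icc ((k : ℝ) * δ) (((k : ℝ) + 1) * δ)) then
    (ν (Set.Icc ((k : ℝ) * δ) (((k : ℝ) + 1) * δ))).toReal ^ q else 0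

/-- `q`-th power moment sum of a measure on `ℝ²` over the `δ`-mesh squares of positive
measure. -/
def msum2 (ν : Measure (ℝ × ℝ)) (q δ : ℝ) : ℝ :=
  ∑' k : ℤ × ℤ,
    if 0 < ν (Set.Icc ((k.1 : ℝ) * δ) (((k.1 : ℝ) + 1) * δ) ×ˢ
        Set.Icc ((k.2 : ℝ) * δ) (((k.2 : ℝ) + 1) * δ)) then
      (ν (Set.Icc ((k.1 : ℝ) * δ) (((k.1 : ℝ) + 1) * δ) ×ˢ
        Set.Icc ((k.2 : ℝ) * δ) (((k.2 : ℝ) + 1) * δ))).toReal ^ q else 0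

/-- Upper `L^q`-spectrum of a measure on `ℝ²`. -/
def upperTau2 (ν : Measure (ℝ × ℝ)) (q : ℝ) : ℝ :=
  limsup (fun δ => Real.log (msum2 ν q δ) / (-Real.log δ)) (𝓝[>] (0:ℝ))

/-- Lower `L^q`-spectrum of a measure on `ℝ²`. -/
def lowerTau2 (ν : Measure (ℝ × ℝ)) (q : ℝ) : ℝ :=
  liminf (fun δ => Real.log (msum2 ν q δ) / (-Real.log δ)) (𝓝[>] (0:ℝ))

theorem abs_deriv_le_of_lipschitzOn_Icc {φ : ℝ → ℝ} {x c : ℝ} (hx : x ∈ Set.Icc (0:ℝ) 1)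
    (hφ : DifferentiableAt ℝ φ x)
    (hc : ∀ u ∈ Set.Icc (0:ℝ) 1, |φ u - φ x| ≤ c * |u - x|) : |deriv φ x| ≤ c := by
  have hu : UniqueDiffWithinAt ℝ (Set.Icc (0:ℝ) 1) x := uniqueDiffOn_Icc zero_lt_one x hx
  have hne : (𝓝[Set.Icc (0:ℝ) 1 \ {x}] x).NeBot := by
    have := uniqueDiffWithinAt_iff_accPt.1 hu
    rwa [accPt_principal_iff_nhdsWithin] at this
  have hlim := hasDerivWithinAt_iff_tendsto_slope.1
    (hφ.hasDerivAt.hasDerivWithinAt (s := Set.Icc (0:ℝ) 1))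
  refine le_of_tendsto hlim.abs ?_
  filter_upwards [self_mem_nhdsWithin] with u hu
  have hpos : 0 < |u - x| := abs_pos.2 (sub_ne_zero.2 hu.2)
  rw [slope_def_field, abs_div, div_le_iff₀ hpos]
  exact hc u hu.1

theorem Sword_fst {ι : Type*} (f : ι → ℝ → ℝ) (g : ι → ℝ × ℝ → ℝ) (l : List ι) (a : ℝ × ℝ) :
    (Sword f g l a).1 = fword f l a.1 := by
  induction l with
  | nil => rfl
  | cons i l ih => simp [Sword, Smap, fword, ih]

theorem Sword_mem {f : ι → ℝ → ℝ} {g : ι → ℝ × ℝ → ℝ} {α d : ℝ} (h : IFSHyp f g α d)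
    (l : List ι) {a : ℝ × ℝ} (ha : a ∈ unitSq) : Sword f g l a ∈ unitSq := by
  induction l with
  | nil => exact ha
  | cons i l ih => exact ⟨h.maps_f i ih.1, h.maps_g i ih⟩

theorem differentiable_Sword {f : ι → ℝ → ℝ} {g : ι → ℝ × ℝ → ℝ} {α d : ℝ}
    (h : IFSHyp f g α d) (l : List ι) : Differentiable ℝ (Sword f g l) := by
  induction l with
  | nil => exact differentiable_id
  | cons i l ih =>
    exact (((h.diff_f i).comp differentiable_fst).prodMk (h.diff_g i)).comp ih

theorem fxw_nil {ι : Type*} (f : ι → ℝ → ℝ) (g : ι → ℝ × ℝ → ℝ) (a : ℝ × ℝ) : fxw f g [] a = 1 := by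
  simp [fxw, Sword]

theorem gyw_nil {ι : Type*} (f : ι → ℝ → ℝ) (g : ι → ℝ × ℝ → ℝ) (a : ℝ × ℝ) : gyw f g [] a = 1 := by
  simp [gyw, Sword]

theorem fxw_cons {f : ι → ℝ → ℝ} {g : ι → ℝ × ℝ → ℝ} {α d : ℝ} (h : IFSHyp f g α d)
    (i : ι) (l : List ι) (a : ℝ × ℝ) :
    fxw f g (i :: l) a = fxw f g [i] (Sword f g l a) * fxw f g l a := by
  have hl : DifferentiableAt ℝ (fun x => (Sword f g l (x, a.2)).1) a.1 :=
    (((differentiable_Sword h l).fst).comp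
      (differentiable_id.prodMk (differentiable_const a.2))) a.1
  exact deriv_comp (h₂ := f i) a.1 (h.diff_f i _) hl

theorem gyw_cons {f : ι → ℝ → ℝ} {g : ι → ℝ × ℝ → ℝ} {α d : ℝ} (h : IFSHyp f g α d)
    (i : ι) (l : List ι) (a : ℝ × ℝ) :
    gyw f g (i :: l) a = gyw f g [i] (Sword f g l a) * gyw f g l a := by
  have hl : DifferentiableAt ℝ (fun y => (Sword f g l (a.1, y)).2) a.2 :=
    (((differentiable_Sword h l).snd).comp
      ((differentiable_const a.1).prodMk differentiable_id)) a.2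
  have hg : DifferentiableAt ℝ (fun y => g i ((Sword f g l a).1, y)) (Sword f g l a).2 :=
    ((h.diff_g i).comp ((differentiable_const _).prodMk differentiable_id)) _
  have hc := deriv_comp a.2 (h₂ := fun y => g i ((Sword f g l a).1, y)) hg hl
  refine Eq.trans ?_ hc
  unfold gyw
  congr 1
  funext y
  have e : Sword f g l (a.1, y) = ((Sword f g l a).1, (Sword f g l (a.1, y)).2) :=
    Prod.ext (by rw [Sword_fst, Sword_fst]) rfl
  change g i (Sword f g l (a.1, y)) = g i ((Sword f g l a).1, (Sword f g l (a.1, y)).2)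
  rw [← e]

theorem IFSHyp.exists_uniform_contraction {f : ι → ℝ → ℝ} {g : ι → ℝ × ℝ → ℝ} {α d : ℝ}
    (h : IFSHyp f g α d) :
    ∃ c : ℝ, 0 < c ∧ c < 1 ∧ ∀ i, ∀ a ∈ unitSq, |fxw f g [i] a| ≤ c ∧ |gyw f g [i] a| ≤ c := by
  choose cf hf0 hf1 hf using h.contr_f
  choose cg hg0 hg1 hg using h.contr_g
  have hev : ∀ᶠ c in 𝓝[<] (1:ℝ), 0 < c ∧ ∀ i, cf i < c ∧ cg i < c := by
    refine ((lt_mem_nhds one_pos).filter_mono nhdsWithin_le_nhds).and (eventually_all.2 fun i => ?_)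
    exact ((lt_mem_nhds (hf1 i)).filter_mono nhdsWithin_le_nhds).and
      ((lt_mem_nhds (hg1 i)).filter_mono nhdsWithin_le_nhds)
  obtain ⟨c, ⟨hc0, hc⟩, hc1⟩ := (hev.and self_mem_nhdsWithin).exists
  refine ⟨c, hc0, hc1, fun i a ha => ⟨?_, ?_⟩⟩
  · exact (abs_deriv_le_of_lipschitzOn_Icc ha.1 (h.diff_f i _)
      fun u hu => hf i u hu _ ha.1).trans (hc i).1.le
  · refine (abs_deriv_le_of_lipschitzOn_Icc ha.2
      (((h.diff_g i).comp ((differentiable_const a.1).prodMk differentiable_id)) a.2)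
      fun u hu => ?_).trans (hc i).2.le
    have := hg i (a.1, u) ⟨ha.1, hu⟩ (a.1, a.2) ha
    simpa [Prod.norm_def, Sword, Smap] using this

theorem IFSHyp.fxw_singleton_pos {f : ι → ℝ → ℝ} {g : ι → ℝ × ℝ → ℝ} {α d : ℝ}
    (h : IFSHyp f g α d) (i : ι) {a : ℝ × ℝ} (ha : a ∈ unitSq) : 0 < fxw f g [i] a := by
  obtain ⟨c, -, -, hc⟩ := h.exists_uniform_contraction
  have h1 : gyw f g [i] a ≤ sSup (gyw f g [i] '' unitSq) :=
    le_csSup ⟨c, by rintro _ ⟨b, hb, rfl⟩; exact (abs_le.1 (hc i b hb).2).2⟩ ⟨a, ha, rfl⟩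
  have h2 : sInf (fxw f g [i] '' unitSq) ≤ fxw f g [i] a :=
    csInf_le ⟨-c, by rintro _ ⟨b, hb, rfl⟩; exact (abs_le.1 (hc i b hb).1).1⟩ ⟨a, ha, rfl⟩
  linarith [h.dom i, h.dom_d i a ha, h.d_pos]

theorem fxw_pos {f : ι → ℝ → ℝ} {g : ι → ℝ × ℝ → ℝ} {α d : ℝ} (h : IFSHyp f g α d)
    (l : List ι) {a : ℝ × ℝ} (ha : a ∈ unitSq) : 0 < fxw f g l a := by
  induction l with
  | nil => simp [fxw_nil]
  | cons i l ih =>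
    rw [fxw_cons h]
    exact mul_pos (h.fxw_singleton_pos i (Sword_mem h l ha)) ih

theorem gyw_pos {f : ι → ℝ → ℝ} {g : ι → ℝ × ℝ → ℝ} {α d : ℝ} (h : IFSHyp f g α d)
    (l : List ι) {a : ℝ × ℝ} (ha : a ∈ unitSq) : 0 < gyw f g l a := by
  induction l with
  | nil => simp [gyw_nil]
  | cons i l ih =>
    rw [gyw_cons h]
    exact mul_pos (h.d_pos.trans_le (h.dom_d i _ (Sword_mem h l ha))) ih

theorem fxw_le_pow {f : ι → ℝ → ℝ} {g : ι → ℝ × ℝ → ℝ} {α d c : ℝ} (h : IFSHyp f g α d)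
    (hc : ∀ i, ∀ a ∈ unitSq, |fxw f g [i] a| ≤ c) (l : List ι) {a : ℝ × ℝ} (ha : a ∈ unitSq) :
    fxw f g l a ≤ c ^ l.length := by
  induction l with
  | nil => simp [fxw_nil]
  | cons i l ih =>
    rw [fxw_cons h, List.length_cons, pow_succ']
    have := hc i _ (Sword_mem h l ha)
    exact mul_le_mul ((le_abs_self _).trans this) ih (fxw_pos h l ha).le
      ((abs_nonneg _).trans this)

theorem gyw_le_pow {f : ι → ℝ → ℝ} {g : ι → ℝ × ℝ → ℝ} {α d c : ℝ} (h : IFSHyp f g α d)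
    (hc : ∀ i, ∀ a ∈ unitSq, |gyw f g [i] a| ≤ c) (l : List ι) {a : ℝ × ℝ} (ha : a ∈ unitSq) :
    gyw f g l a ≤ c ^ l.length := by
  induction l with
  | nil => simp [gyw_nil]
  | cons i l ih =>
    rw [gyw_cons h, List.length_cons, pow_succ']
    have := hc i _ (Sword_mem h l ha)
    exact mul_le_mul ((le_abs_self _).trans this) ih (gyw_pos h l ha).le
      ((abs_nonneg _).trans this)

theorem sv2_pos {a b c : ℝ} (ha : 0 < a) (hc : 0 < c) : 0 < sv2 a b c := by
  apply Real.sqrt_pos.2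
  have hac := mul_pos ha hc
  have : Real.sqrt ((a ^ 2 + b ^ 2 + c ^ 2) ^ 2 - 4 * (a * c) ^ 2) < a ^ 2 + b ^ 2 + c ^ 2 := by
    rw [Real.sqrt_lt' (by positivity)]
    have : 0 < (a * c) ^ 2 := by positivity
    linarith
  linarith

theorem sv2_le_sqrt_mul {a b c : ℝ} (ha : 0 < a) (hc : 0 < c) :
    sv2 a b c ≤ Real.sqrt (a * c) := by
  apply Real.sqrt_le_sqrt
  have hac := mul_pos ha hc
  have hT : 2 * (a * c) ≤ a ^ 2 + b ^ 2 + c ^ 2 := by nlinarith [sq_nonneg (a - c), sq_nonneg b]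
  have : a ^ 2 + b ^ 2 + c ^ 2 - 2 * (a * c) ≤
      Real.sqrt ((a ^ 2 + b ^ 2 + c ^ 2) ^ 2 - 4 * (a * c) ^ 2) := by
    apply Real.le_sqrt_of_sq_le
    nlinarith
  linarith

theorem alphaTwo_pos {f : ι → ℝ → ℝ} {g : ι → ℝ × ℝ → ℝ} {α d : ℝ} (h : IFSHyp f g α d)
    (l : List ι) {a : ℝ × ℝ} (ha : a ∈ unitSq) : 0 < alphaTwo f g l a :=
  sv2_pos (fxw_pos h l ha) (gyw_pos h l ha)

theorem alphaTwo_le_pow {f : ι → ℝ → ℝ} {g : ι → ℝ × ℝ → ℝ} {α d c : ℝ} (h : IFSHyp f g α d)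
    (hc0 : 0 ≤ c) (hc : ∀ i, ∀ a ∈ unitSq, |fxw f g [i] a| ≤ c ∧ |gyw f g [i] a| ≤ c)
    (l : List ι) {a : ℝ × ℝ} (ha : a ∈ unitSq) : alphaTwo f g l a ≤ c ^ l.length := by
  refine (sv2_le_sqrt_mul (fxw_pos h l ha) (gyw_pos h l ha)).trans
    (Real.sqrt_le_left (pow_nonneg hc0 _) |>.2 ?_)
  rw [sq]
  exact mul_le_mul (fxw_le_pow h (fun i b hb => (hc i b hb).1) l ha)
    (gyw_le_pow h (fun i b hb => (hc i b hb).2) l ha) (gyw_pos h l ha).le (pow_nonneg hc0 _)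

theorem pword_nonneg {ι : Type*} {p : ι → ℝ} (hp : ∀ i, 0 ≤ p i) (l : List ι) : 0 ≤ pword p l :=
  List.prod_nonneg (by simpa using fun i _ => hp i)

theorem psiSV_nonneg {ι : Type*} {f : ι → ℝ → ℝ} {g : ι → ℝ × ℝ → ℝ} {p : ι → ℝ} (hp : ∀ i, 0 ≤ p i)
    (s q βq : ℝ) (a : ℝ × ℝ) (l : List ι) : 0 ≤ psiSV f g p s q βq a l :=
  mul_nonneg (mul_nonneg (Real.rpow_nonneg (pword_nonneg hp l) _)
    (Real.rpow_nonneg (Real.sqrt_nonneg _) _)) (Real.rpow_nonneg (Real.sqrt_nonneg _) _)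

theorem psiSV_le_pow_mul {f : ι → ℝ → ℝ} {g : ι → ℝ × ℝ → ℝ} {α d c : ℝ}
    (h : IFSHyp f g α d) (hc0 : 0 ≤ c)
    (hc : ∀ i, ∀ a ∈ unitSq, |fxw f g [i] a| ≤ c ∧ |gyw f g [i] a| ≤ c)
    {p : ι → ℝ} (hp : ∀ i, 0 ≤ p i) {s t : ℝ} (hst : s ≤ t) (q βq : ℝ) {a : ℝ × ℝ}
    (ha : a ∈ unitSq) (l : List ι) :
    psiSV f g p t q βq a l ≤ (c ^ (t - s)) ^ l.length * psiSV f g p s q βq a l := by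
  have e : psiSV f g p t q βq a l = alphaTwo f g l a ^ (t - s) * psiSV f g p s q βq a l := by
    unfold psiSV
    rw [show t - βq = (t - s) + (s - βq) by ring, Real.rpow_add (alphaTwo_pos h l ha)]
    ring
  rw [e]
  refine mul_le_mul_of_nonneg_right ?_ (psiSV_nonneg hp _ _ _ _ _)
  rw [← Real.rpow_mul_natCast hc0, mul_comm, Real.rpow_natCast_mul hc0]
  exact Real.rpow_le_rpow (alphaTwo_pos h l ha).le (alphaTwo_le_pow h hc0 hc l ha)
    (sub_nonneg.2 hst)

theorem PsiSum_le_pow_mul {f : ι → ℝ → ℝ} {g : ι → ℝ × ℝ → ℝ} {α d c : ℝ}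
    (h : IFSHyp f g α d) (hc0 : 0 ≤ c)
    (hc : ∀ i, ∀ a ∈ unitSq, |fxw f g [i] a| ≤ c ∧ |gyw f g [i] a| ≤ c)
    {p : ι → ℝ} (hp : ∀ i, 0 ≤ p i) {s t : ℝ} (hst : s ≤ t) (q βq : ℝ) {a : ℝ × ℝ}
    (ha : a ∈ unitSq) (k : ℕ) :
    PsiSum f g p t q βq a k ≤ (c ^ (t - s)) ^ k * PsiSum f g p s q βq a k := by
  unfold PsiSum
  rw [Finset.mul_sum]
  refine Finset.sum_le_sum fun w _ => ?_
  simpa using psiSV_le_pow_mul h hc0 hc hp hst q βq ha (List.ofFn w)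

theorem PsiSum_nonneg {f : ι → ℝ → ℝ} {g : ι → ℝ × ℝ → ℝ} {p : ι → ℝ} (hp : ∀ i, 0 ≤ p i)
    (s q βq : ℝ) (a : ℝ × ℝ) (k : ℕ) : 0 ≤ PsiSum f g p s q βq a k :=
  Finset.sum_nonneg fun _ _ => psiSV_nonneg hp _ _ _ _ _

theorem summable_psiSV {f : ι → ℝ → ℝ} {g : ι → ℝ × ℝ → ℝ} {p : ι → ℝ} (hp : ∀ i, 0 ≤ p i)
    {s q βq : ℝ} {a : ℝ × ℝ} (hs : Summable (PsiSum f g p s q βq a)) :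
    Summable (psiSV f g p s q βq a) := by
  rw [← List.equivSigmaTuple.symm.summable_iff]
  refine (summable_sigma_of_nonneg fun _ => psiSV_nonneg hp _ _ _ _ _).2 ⟨fun _ => Summable.of_finite, ?_⟩
  simp only [tsum_fintype]
  exact hs

theorem summable_PsiSum_of_tendsto_one {f : ι → ℝ → ℝ} {g : ι → ℝ × ℝ → ℝ} {α d : ℝ}
    (h : IFSHyp f g α d) {p : ι → ℝ} (hp : ∀ i, 0 ≤ p i) {s t q βq : ℝ} (hst : s < t)
    {a : ℝ × ℝ} (ha : a ∈ unitSq)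
    (hs : Tendsto (fun k : ℕ => PsiSum f g p s q βq a k ^ ((k : ℝ)⁻¹)) atTop (𝓝 1)) :
    Summable (PsiSum f g p t q βq a) := by
  obtain ⟨c, hc0, hc1, hc⟩ := h.exists_uniform_contraction
  set ρ := c ^ (t - s)
  have hρ0 : 0 < ρ := Real.rpow_pos_of_pos hc0 _
  have hρ1 : ρ < 1 := Real.rpow_lt_one hc0.le hc1 (sub_pos.2 hst)
  obtain ⟨r, hr1, hr⟩ := exists_between ((one_lt_inv₀ hρ0).2 hρ1)
  have hρr : ρ * r < 1 := by
    rwa [lt_inv_comm₀ (by linarith) hρ0, ← one_div, lt_div_iff₀ (by linarith)] at hr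
  refine Summable.of_norm_bounded_eventually_nat
    (summable_geometric_of_lt_one (by positivity : 0 ≤ ρ * r) hρr) ?_
  filter_upwards [hs.eventually_lt_const hr1, eventually_ne_atTop 0] with k hk hk0
  rw [Real.norm_of_nonneg (PsiSum_nonneg hp _ _ _ _ _), mul_pow]
  refine (PsiSum_le_pow_mul h hc0.le hc hp hst.le q βq ha k).trans
    (mul_le_mul_of_nonneg_left ?_ (by positivity))
  have hn := PsiSum_nonneg (f := f) (g := g) hp s q βq a k
  calc PsiSum f g p s q βq a k = (PsiSum f g p s q βq a k ^ ((k : ℝ)⁻¹)) ^ k :=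
        (Real.rpow_inv_natCast_pow hn hk0).symm
    _ ≤ r ^ k := pow_le_pow_left₀ (Real.rpow_nonneg hn _) hk.le _

theorem stopping_sum_upper {ι : Type*} [Fintype ι]
    (f : ι → ℝ → ℝ) (g : ι → ℝ × ℝ → ℝ) (α d : ℝ) (h : IFSHyp f g α d)
    (p : ι → ℝ) (hp : ProbVec p)
    (μ : Measure (ℝ × ℝ)) [IsProbabilityMeasure μ]
    (hμ : μ = ∑ i : ι, ENNReal.ofReal (p i) • μ.map (Smap f g i))
    (β : ℝ → ℝ)
    (hβ : ∀ q : ℝ, 0 ≤ q → Tendsto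
      (fun δ => Real.log (msum1 (μ.map Prod.fst) q δ) / (-Real.log δ)) (𝓝[>] (0:ℝ)) (𝓝 (β q)))
    (P : ℝ → ℝ → ℝ)
    (hP : ∀ s q : ℝ, 0 ≤ q → ∀ a ∈ unitSq,
      Tendsto (fun k : ℕ => PsiSum f g p s q (β q) a k ^ ((k : ℝ)⁻¹)) atTop (𝓝 (P s q)))
    (γ : ℝ → ℝ) (hγ : ∀ q : ℝ, 0 ≤ q → P (γ q) q = 1)
    (a : ℝ × ℝ) (ha : a ∈ unitSq) (q t : ℝ) (hq : 0 ≤ q) (ht : γ q < t) :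
    ∃ K : ℝ, ∀ δ : ℝ, 0 < δ → δ ≤ 1 →
      (∑' l : {l : List ι // l ∈ stopping f g a δ}, psiSV f g p t q (β q) a l.1) ≤ K := by
  have hp0 : ∀ i, 0 ≤ p i := fun i => (hp.1 i).1.le
  have hs := summable_psiSV hp0 (summable_PsiSum_of_tendsto_one h hp0 ht ha
    (hγ q hq ▸ hP (γ q) q hq a ha))
  exact ⟨_, fun δ _ _ => hs.tsum_subtype_le _ (stopping f g a δ) (psiSV_nonneg hp0 _ _ _ _)⟩

end
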